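/- arXiv:2408.17170 — 8 statements merged into one kernel-verified Lean document; each statement's English description precedes it below -/
import Mathlib

section
/- Let (Ω, 𝒜, μ) be a measure space, I a finite index set, and (A_i)_{i∈I} measurable sets with μ(A_i) < ∞ for every i ∈ I. Then μ(⋃_{i∈I} A_i) = Σ_{i∈I} Σ_{T ⊆ I∖{i}} ((−1)^{|T|} / (|T| + 1)) · μ(A_i ∩ ⋂_{j∈T} A_j), where for T = ∅ the intersection ⋂_{j∈T} A_j is interpreted as Ω, so the T = ∅ term is μ(A_i). -/
open MeasureTheory

/-- Distributing a sum over the nonempty subsets of `s` equally among the elements of each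
subset. -/
theorem Finset.sum_nonempty_powerset_eq_sum_sum_powerset_erase {ι K : Type*} [DecidableEq ι]
    [Field K] [CharZero K] (s : Finset ι) (f : Finset ι → K) :
    ∑ t ∈ s.powerset with t.Nonempty, f t =
      ∑ i ∈ s, ∑ T ∈ (s.erase i).powerset, f (insert i T) / (T.card + 1) := by
  calc ∑ t ∈ s.powerset with t.Nonempty, f t
    _ = ∑ t ∈ s.powerset with t.Nonempty, ∑ i ∈ t, f t / t.card := by
      refine Finset.sum_congr rfl fun t ht => ?_
      have hcard : (t.card : K) ≠ 0 :=
        Nat.cast_ne_zero.2 (Finset.card_ne_zero.2 (Finset.mem_filter.1 ht).2)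
      rw [Finset.sum_const, nsmul_eq_mul, mul_div_cancel₀ _ hcard]
    _ = ∑ i ∈ s, ∑ t ∈ s.powerset with i ∈ t, f t / t.card := by
      refine Finset.sum_comm' fun t i => ?_
      simp only [Finset.mem_filter, Finset.mem_powerset]
      exact ⟨fun h => ⟨⟨h.1.1, h.2⟩, h.1.1 h.2⟩, fun h => ⟨⟨h.1.1, i, h.1.2⟩, h.1.2⟩⟩
    _ = _ := by
      refine Finset.sum_congr rfl fun i hi => ?_
      refine Finset.sum_nbij' (fun t => t.erase i) (fun T => insert i T) ?_ ?_ ?_ ?_ ?_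
      · intro t ht
        simp only [Finset.mem_filter, Finset.mem_powerset] at ht ⊢
        exact Finset.erase_subset_erase i ht.1
      · intro T hT
        simp only [Finset.mem_filter, Finset.mem_powerset] at hT ⊢
        exact ⟨Finset.insert_subset hi (hT.trans (Finset.erase_subset i s)),
          Finset.mem_insert_self i T⟩
      · intro t ht
        exact Finset.insert_erase (Finset.mem_filter.1 ht).2
      · intro T hT
        exact Finset.erase_insert fun h =>
          Finset.notMem_erase i s (Finset.mem_powerset.1 hT h)
      · intro t ht
        have hit := (Finset.mem_filter.1 ht).2
        rw [Finset.insert_erase hit, ← Finset.card_erase_add_one hit]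
        push_cast
        rfl

/-- pointwise-weighted inclusion–exclusion. For a finite family of measurable
sets `A i`, `i ∈ I`, each of finite measure,
`μ(⋃_{i∈I} A i) = ∑_{i∈I} ∑_{T ⊆ I∖{i}} ((−1)^{|T|}/(|T|+1)) · μ(A i ∩ ⋂_{j∈T} A j)`,
where for `T = ∅` the intersection `⋂_{j∈T} A j` is the whole space, so that term is `μ(A i)`. -/
theorem measure_biUnion_weighted_inclusion_exclusion {Ω ι : Type*} [MeasurableSpace Ω]
    [DecidableEq ι] (μ : Measure Ω) (I : Finset ι) (A : ι → Set Ω)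
    (hmeas : ∀ i ∈ I, MeasurableSet (A i)) (hfin : ∀ i ∈ I, μ (A i) < ⊤) :
    (μ (⋃ i ∈ I, A i)).toReal =
      ∑ i ∈ I, ∑ T ∈ (I.erase i).powerset,
        ((-1 : ℝ) ^ T.card / (T.card + 1)) * (μ (A i ∩ ⋂ j ∈ T, A j)).toReal := by
  have hsum := measureReal_biUnion_eq_sum_powerset (μ := μ) (t := I) (s := A) hmeas
    (fun i hi => (hfin i hi).ne)
  rw [Finset.sum_nonempty_powerset_eq_sum_sum_powerset_erase] at hsum
  refine hsum.trans (Finset.sum_congr rfl fun i _ => Finset.sum_congr rfl fun T hT => ?_)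
  have hiT : i ∉ T := fun h => Finset.notMem_erase i I (Finset.mem_powerset.1 hT h)
  rw [Finset.card_insert_of_notMem hiT, Finset.set_biInter_insert, Measure.real]
  ring
end

section
/- Let I be a finite index set, (A_j)_{j∈I} subsets of a set Ω, let i ∈ I, and let z ∈ A_i. Then #{j ∈ I∖{i} : z ∈ A_j} / #{j ∈ I : z ∈ A_j} = Σ_{∅ ≠ T ⊆ I∖{i}} ((−1)^{|T|+1} / (|T| + 1)) · ∏_{j∈T} 1_{A_j}(z), where 1_{A_j} denotes the indicator function of A_j. (Note the denominator on the left is at least 1 since z ∈ A_i.) -/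
open Classical

/-- The alternating sum of `n.choose k / (k + 1)` is `1 / (n + 1)`. -/
theorem sum_range_neg_one_pow_div_succ_mul_choose (n : ℕ) :
    ∑ k ∈ Finset.range (n + 1), (n.choose k : ℝ) * ((-1) ^ k / (k + 1)) = 1 / (n + 1) := by
  have h := Int.alternating_sum_range_choose_of_ne (Nat.succ_ne_zero n)
  rw [Finset.sum_range_succ'] at h
  have h' : (∑ k ∈ Finset.range (n + 1), (-1 : ℝ) ^ (k + 1) * ((n + 1).choose (k + 1) : ℝ)) + 1
      = 0 := by
    simpa using congrArg (Int.cast : ℤ → ℝ) h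
  have hn : (n + 1 : ℝ) ≠ 0 := by positivity
  rw [eq_div_iff hn, Finset.sum_mul]
  refine Eq.trans ?_ (neg_eq_of_add_eq_zero_right h')
  rw [← Finset.sum_neg_distrib]
  refine Finset.sum_congr rfl fun k _ => ?_
  have hc : (n + 1 : ℝ) * n.choose k = (n + 1).choose (k + 1) * (k + 1) := by
    exact_mod_cast Nat.add_one_mul_choose_eq n k
  have hk : (k + 1 : ℝ) ≠ 0 := by positivity
  field_simp
  linear_combination (-1 : ℝ) ^ k * hc

theorem Finset.sum_powerset_neg_one_pow_card_div_succ {ι : Type*} (S : Finset ι) :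
    ∑ T ∈ S.powerset, (-1 : ℝ) ^ T.card / (T.card + 1) = 1 / (S.card + 1) := by
  rw [Finset.sum_powerset_apply_card (fun k => (-1 : ℝ) ^ k / (k + 1))]
  simpa only [nsmul_eq_mul] using sum_range_neg_one_pow_div_succ_mul_choose S.card

theorem Finset.sum_nonempty_powerset_neg_one_pow_card_div_succ {ι : Type*} (S : Finset ι) :
    ∑ T ∈ S.powerset.filter (fun T => T.Nonempty), (-1 : ℝ) ^ (T.card + 1) / (T.card + 1) =
      S.card / (S.card + 1) := by
  have herase : S.powerset.filter (fun T => T.Nonempty) = S.powerset.erase ∅ := by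
    ext T
    simp [Finset.nonempty_iff_ne_empty, and_comm]
  have h := Finset.sum_powerset_neg_one_pow_card_div_succ S
  rw [← Finset.add_sum_erase _ _ (Finset.empty_mem_powerset S)] at h
  have hS : (S.card + 1 : ℝ) ≠ 0 := by positivity
  have hdiv : (S.card : ℝ) / (S.card + 1) = 1 - 1 / (S.card + 1) := by
    field_simp
    ring
  rw [herase, hdiv, ← h]
  simp [pow_succ, neg_div]

/-- pointwise indicator identity. For a finite family of sets `A j`, `j ∈ I`,
`i ∈ I` and `z ∈ A i`,
`#{j ∈ I∖{i} : z ∈ A j} / #{j ∈ I : z ∈ A j}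
  = ∑_{∅ ≠ T ⊆ I∖{i}} ((−1)^{|T|+1}/(|T|+1)) ∏_{j∈T} 1_{A j}(z)`. -/
theorem indicator_ratio_inclusion_exclusion {Ω ι : Type*} (I : Finset ι) (A : ι → Set Ω)
    (i : ι) (hi : i ∈ I) (z : Ω) (hz : z ∈ A i) :
    (((I.erase i).filter (fun j => z ∈ A j)).card : ℝ) /
        ((I.filter (fun j => z ∈ A j)).card : ℝ) =
      ∑ T ∈ (I.erase i).powerset.filter (fun T => T.Nonempty),
        ((-1 : ℝ) ^ (T.card + 1) / (T.card + 1)) *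
          ∏ j ∈ T, (if z ∈ A j then (1 : ℝ) else 0) := by
  have hcard : (I.filter (fun j => z ∈ A j)).card =
      ((I.erase i).filter (fun j => z ∈ A j)).card + 1 := by
    rw [Finset.filter_erase,
      Finset.card_erase_add_one (Finset.mem_filter.mpr ⟨hi, hz⟩)]
  rw [hcard, Nat.cast_add_one, ← Finset.sum_nonempty_powerset_neg_one_pow_card_div_succ]
  simp only [Finset.prod_ite_zero, Finset.prod_const_one, mul_ite, mul_one, mul_zero]
  rw [← Finset.sum_filter]
  refine Finset.sum_congr ?_ fun _ _ => rfl
  ext T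
  simp only [Finset.mem_filter, Finset.mem_powerset, Finset.subset_iff]
  grind
end

section
/- Let R > 0 and let r satisfy 0 ≤ r ≤ (√2 − 1)·R. Let (x_i, R_i)_{1 ≤ i ≤ 4} be four marked points in ℝ² with R_i ≥ R for all i and |x_i − x_j| > R_i + R_j for all i ≠ j. Then ⋂_{i=1}^{4} B(x_i, R_i + r) = ∅, i.e., no point of the plane lies in all four enlarged balls. -/
open Module in
theorem card_le_finrank_succ_of_pairwise_inner_neg {E : Type*} [NormedAddCommGroup E]
    [InnerProductSpace ℝ E] [FiniteDimensional ℝ E] {n : ℕ} (v : Fin n → E)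
    (hv : Pairwise fun i j ↦ inner ℝ (v i) (v j) < 0) : n ≤ finrank ℝ E + 1 := by
  cases n with
  | zero => exact Nat.zero_le _
  | succ n =>
    have hli : LinearIndependent ℝ fun i : Fin n ↦ v i.succ := by
      refine LinearMap.BilinForm.linearIndependent_of_pairwise_le_zero (innerₗ E) ?_
        (-innerₗ E (v 0)) _ (fun i ↦ ?_) (fun i j hij ↦ ?_)
      · intro x hx
        simpa using pow_pos (norm_pos_iff.mpr hx) 2
      · simpa using hv (Fin.succ_ne_zero i).symm
      · simpa using (hv ((Fin.succ_injective n).ne hij)).le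
    simpa using hli.fintype_card_le_finrank

theorem inner_neg_of_norm_le_add_of_add_lt_norm_sub {E : Type*} [NormedAddCommGroup E]
    [InnerProductSpace ℝ E] {R r a b : ℝ} {u v : E} (hR : 0 < R) (hr0 : 0 ≤ r)
    (hr : r ≤ (Real.sqrt 2 - 1) * R) (ha : R ≤ a) (hb : R ≤ b) (hu : ‖u‖ ≤ a + r)
    (hv : ‖v‖ ≤ b + r) (huv : a + b < ‖u - v‖) : inner ℝ u v < 0 := by
  have hsqrt : Real.sqrt 2 ^ 2 = 2 := Real.sq_sqrt (by norm_num)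
  have hs0 := Real.sqrt_nonneg 2
  have hrR : Real.sqrt 2 * r ≤ R - r := by nlinarith
  have hprod : 2 * r ^ 2 ≤ (a - r) * (b - r) :=
    calc 2 * r ^ 2 = (Real.sqrt 2 * r) * (Real.sqrt 2 * r) := by linear_combination -r ^ 2 * hsqrt
      _ ≤ (a - r) * (b - r) := by gcongr <;> first | positivity | nlinarith
  have hsub := norm_sub_sq_real u v
  have hu2 : ‖u‖ ^ 2 ≤ (a + r) ^ 2 := by gcongr
  have hv2 : ‖v‖ ^ 2 ≤ (b + r) ^ 2 := by gcongr
  have huv2 : (a + b) ^ 2 < ‖u - v‖ ^ 2 := by gcongr; linarith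
  nlinarith

/-- in the plane, if `R > 0`, `0 ≤ r ≤ (√2 − 1)·R`, and `(x i, Ri i)` are four
marked points with `Ri i ≥ R` satisfying the hard-core condition
`|x i − x j| > Ri i + Ri j` for `i ≠ j`, then the four enlarged balls
`B(x i, Ri i + r)` have empty intersection. -/
theorem four_enlarged_balls_empty_inter_dim_two (R r : ℝ) (hR : 0 < R) (hr0 : 0 ≤ r)
    (hr : r ≤ (Real.sqrt 2 - 1) * R)
    (x : Fin 4 → EuclideanSpace ℝ (Fin 2)) (Ri : Fin 4 → ℝ)
    (hRi : ∀ i, R ≤ Ri i)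
    (hhc : ∀ i j, i ≠ j → Ri i + Ri j < dist (x i) (x j)) :
    ⋂ i, Metric.closedBall (x i) (Ri i + r) = ∅ := by
  refine Set.eq_empty_of_forall_notMem fun y hy ↦ ?_
  simp only [Set.mem_iInter, mem_closedBall_iff_norm] at hy
  have hcard := card_le_finrank_succ_of_pairwise_inner_neg (fun i ↦ y - x i) fun i j hij ↦
    inner_neg_of_norm_le_add_of_add_lt_norm_sub hR hr0 hr (hRi i) (hRi j) (hy i) (hy j)
      (by simpa [dist_eq_norm, norm_sub_rev] using hhc i j hij)
  simp at hcard
end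

section
/- Let R > 0, let 0 ≤ r ≤ (√2 − 1)·R, and let (x_i, R_i)_{i∈I} be a finite marked configuration in ℝ² with R_i ≥ R for all i and satisfying the hard-core condition. Writing B_i := B(x_i, R_i + r), the inclusion–exclusion expansion truncates exactly at third order: vol(⋃_{i∈I} B_i) = Σ_{i} vol(B_i) − Σ_{\{i,j\} ⊆ I} vol(B_i ∩ B_j) + Σ_{\{i,j,k\} ⊆ I} vol(B_i ∩ B_j ∩ B_k), where the second and third sums run over all 2-element and 3-element subsets of I respectively. -/
open MeasureTheory

/-- Among four vectors of the Euclidean plane, two enclose an angle of at most `π / 2`. -/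
lemma exists_inner_nonneg_of_three_lt_card {ι : Type*} (S : Finset ι) (hS : 3 < S.card)
    (v : ι → EuclideanSpace ℝ (Fin 2)) :
    ∃ i ∈ S, ∃ j ∈ S, i ≠ j ∧ 0 ≤ inner ℝ (v i) (v j) := by
  classical
  by_contra! h
  obtain ⟨T, hTS, hT⟩ := Finset.exists_subset_card_eq (Nat.succ_le_of_lt hS)
  obtain ⟨a, b, c, d, hab, hac, had, hbc, hbd, hcd, rfl⟩ := Finset.card_eq_four.mp hT
  simp only [Finset.insert_subset_iff, Finset.singleton_subset_iff] at hTS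
  obtain ⟨ha, hb, hc, hd⟩ := hTS
  have det_mul_neg : ∀ i ∈ S, ∀ j ∈ S, a ≠ i → a ≠ j → i ≠ j →
      (v a 0 * v i 1 - v a 1 * v i 0) * (v a 0 * v j 1 - v a 1 * v j 0) < 0 := by
    intro i hi j hj hai haj hij
    have h1 := h a ha i hi hai
    have h2 := h a ha j hj haj
    have h3 := h i hi j hj hij
    simp only [PiLp.inner_apply, Fin.sum_univ_two, RCLike.inner_apply, conj_trivial] at h1 h2 h3
    nlinarith [mul_pos_of_neg_of_neg h1 h2,
      mul_nonneg (add_nonneg (sq_nonneg (v a 0)) (sq_nonneg (v a 1))) (neg_nonneg.mpr h3.le)]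
  have hbc' := det_mul_neg b hb c hc hab hac hbc
  have hbd' := det_mul_neg b hb d hd hab had hbd
  have hcd' := det_mul_neg c hc d hd hac had hcd
  generalize v a 0 * v b 1 - v a 1 * v b 0 = p at *
  generalize v a 0 * v c 1 - v a 1 * v c 0 = q at *
  generalize v a 0 * v d 1 - v a 1 * v d 0 = s at *
  nlinarith [mul_neg_of_pos_of_neg (mul_pos_of_neg_of_neg hbc' hbd') hcd', sq_nonneg (p * q * s)]

/-- If both radii are at least `(√2 + 1) r`, then enlarging them by `r` keeps the sum of their
squares below the square of the original sum. -/
lemma add_sq_add_add_sq_le_add_sq {R r a b : ℝ} (hr0 : 0 ≤ r) (hr : r ≤ (Real.sqrt 2 - 1) * R)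
    (ha : R ≤ a) (hb : R ≤ b) : (a + r) ^ 2 + (b + r) ^ 2 ≤ (a + b) ^ 2 := by
  have h2 : Real.sqrt 2 ^ 2 = 2 := Real.sq_sqrt zero_le_two
  have hRr : Real.sqrt 2 * r ≤ R - r := by
    linear_combination R * h2 +
      mul_le_mul_of_nonneg_left hr (add_nonneg (Real.sqrt_nonneg 2) zero_le_one)
  have hs : 0 ≤ Real.sqrt 2 * r := mul_nonneg (Real.sqrt_nonneg 2) hr0
  have := mul_le_mul (hRr.trans (sub_le_sub_right ha r)) (hRr.trans (sub_le_sub_right hb r)) hs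
    (hs.trans (hRr.trans (sub_le_sub_right ha r)))
  nlinarith

/-- The inclusion–exclusion formula truncates at third order when no point lies in four of the
sets. -/
lemma measureReal_biUnion_eq_of_card_filter_le_three {α ι : Type*} [MeasurableSpace α]
    (μ : Measure α) (I : Finset ι) (B : ι → Set α) (hB : ∀ i ∈ I, MeasurableSet (B i))
    (hfin : ∀ i ∈ I, μ (B i) ≠ ⊤)
    (hcard : ∀ y, ∀ S ⊆ I, (∀ i ∈ S, y ∈ B i) → S.card ≤ 3) :
    μ.real (⋃ i ∈ I, B i) = ∑ i ∈ I, μ.real (B i)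
      - ∑ T ∈ I.powersetCard 2, μ.real (⋂ i ∈ T, B i)
      + ∑ T ∈ I.powersetCard 3, μ.real (⋂ i ∈ T, B i) := by
  classical
  have hmeas : ∀ k, ∀ T ∈ I.powersetCard k, MeasurableSet (⋂ i ∈ T, B i) := fun k T hT ↦
    T.measurableSet_biInter fun i hi ↦ hB i ((Finset.mem_powersetCard.mp hT).1 hi)
  have hint : ∀ k, k ≠ 0 → ∀ T ∈ I.powersetCard k,
      Integrable ((⋂ i ∈ T, B i).indicator (1 : α → ℝ)) μ := by
    intro k hk T hT
    obtain ⟨hTI, hTk⟩ := Finset.mem_powersetCard.mp hT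
    obtain ⟨i, hi⟩ := Finset.card_ne_zero.mp (hTk.trans_ne hk)
    exact (integrable_indicator_iff (hmeas k T hT)).mpr <| integrableOn_const
      (measure_ne_top_of_subset (Set.biInter_subset_of_mem hi) (hfin i (hTI hi)))
  have hint1 : ∀ i ∈ I, Integrable ((B i).indicator (1 : α → ℝ)) μ := fun i hi ↦
    (integrable_indicator_iff (hB i hi)).mpr <| integrableOn_const (hfin i hi)
  have hsum : ∀ k, k ≠ 0 → ∑ T ∈ I.powersetCard k, μ.real (⋂ i ∈ T, B i) =
      ∫ y, ∑ T ∈ I.powersetCard k, (⋂ i ∈ T, B i).indicator (1 : α → ℝ) y ∂μ := by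
    intro k hk
    rw [integral_finsetSum _ (hint k hk)]
    exact Finset.sum_congr rfl fun T hT ↦ (integral_indicator_one (hmeas k T hT)).symm
  have hsum1 : ∑ i ∈ I, μ.real (B i) = ∫ y, ∑ i ∈ I, (B i).indicator (1 : α → ℝ) y ∂μ := by
    rw [integral_finsetSum _ hint1]
    exact Finset.sum_congr rfl fun i hi ↦ (integral_indicator_one (hB i hi)).symm
  have hI1 : Integrable (fun y ↦ ∑ i ∈ I, (B i).indicator (1 : α → ℝ) y) μ :=
    integrable_finsetSum _ hint1
  have hI : ∀ k, k ≠ 0 →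
      Integrable (fun y ↦ ∑ T ∈ I.powersetCard k, (⋂ i ∈ T, B i).indicator (1 : α → ℝ) y) μ :=
    fun k hk ↦ integrable_finsetSum _ (hint k hk)
  rw [hsum 2 two_ne_zero, hsum 3 three_ne_zero, hsum1,
    ← integral_sub hI1 (hI 2 two_ne_zero),
    ← integral_add (f := fun y ↦ _ - _) (hI1.sub (hI 2 two_ne_zero)) (hI 3 three_ne_zero),
    ← integral_indicator_one (I.measurableSet_biUnion hB)]
  refine integral_congr_ae (Filter.Eventually.of_forall fun y ↦ ?_)
  have hchoose : ∀ k, ∑ T ∈ I.powersetCard k, (⋂ i ∈ T, B i).indicator (1 : α → ℝ) y =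
      ((I.filter (y ∈ B ·)).card.choose k : ℝ) := by
    intro k
    rw [← Finset.card_powersetCard, Finset.cast_card, ← Finset.sum_subset
      (Finset.powersetCard_mono (Finset.filter_subset (y ∈ B ·) I) : _ ⊆ I.powersetCard k)]
    · refine Finset.sum_congr rfl fun T hT ↦ Set.indicator_of_mem ?_ _
      exact Set.mem_iInter₂.mpr fun i hi ↦
        (Finset.mem_filter.mp ((Finset.mem_powersetCard.mp hT).1 hi)).2
    · intro T hT hT'
      refine Set.indicator_of_notMem (fun hy ↦ hT' ?_) _
      obtain ⟨hTI, hTk⟩ := Finset.mem_powersetCard.mp hT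
      exact Finset.mem_powersetCard.mpr
        ⟨fun i hi ↦ Finset.mem_filter.mpr ⟨hTI hi, Set.mem_iInter₂.mp hy i hi⟩, hTk⟩
  have hone : ∑ i ∈ I, (B i).indicator (1 : α → ℝ) y = ((I.filter (y ∈ B ·)).card : ℝ) := by
    simp [Set.indicator_apply]
  have hunion : (⋃ i ∈ I, B i).indicator (1 : α → ℝ) y =
      if (I.filter (y ∈ B ·)).card = 0 then 0 else 1 := by
    simp only [Set.indicator_apply, Finset.card_eq_zero, Finset.filter_eq_empty_iff,
      Set.mem_iUnion, Pi.one_apply]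
    by_cases h : ∃ i ∈ I, y ∈ B i
    · obtain ⟨i, hi, hy⟩ := h
      rw [if_pos ⟨i, hi, hy⟩, if_neg fun h ↦ h hi hy]
    · rw [if_neg (by simpa using h), if_pos fun i hi hy ↦ h ⟨i, hi, hy⟩]
  have hle := hcard y (I.filter (y ∈ B ·)) (Finset.filter_subset _ _)
    fun i hi ↦ (Finset.mem_filter.mp hi).2
  simp only [hchoose, hone, hunion]
  generalize (I.filter (y ∈ B ·)).card = n at hle ⊢
  interval_cases n <;> norm_num [Nat.choose]

/-- truncation of inclusion–exclusion in the plane. If `R > 0`,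
`0 ≤ r ≤ (√2 − 1)·R`, and `(x i, Ri i)_{i ∈ I}` is a finite marked configuration in `ℝ²` with
`Ri i ≥ R` satisfying the hard-core condition, then with `B i = B(x i, Ri i + r)`,
`vol(⋃ B i) = ∑ vol(B i) − ∑_{{i,j}⊆I} vol(B i ∩ B j) + ∑_{{i,j,k}⊆I} vol(B i ∩ B j ∩ B k)`. -/
theorem area_interaction_three_body_expansion {ι : Type*} [DecidableEq ι]
    (R r : ℝ) (hR : 0 < R) (hr0 : 0 ≤ r) (hr : r ≤ (Real.sqrt 2 - 1) * R)
    (I : Finset ι) (x : ι → EuclideanSpace ℝ (Fin 2)) (Ri : ι → ℝ)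
    (hRi : ∀ i ∈ I, R ≤ Ri i)
    (hhc : ∀ i ∈ I, ∀ j ∈ I, i ≠ j → Ri i + Ri j < dist (x i) (x j)) :
    (volume (⋃ i ∈ I, Metric.closedBall (x i) (Ri i + r))).toReal =
      ∑ i ∈ I, (volume (Metric.closedBall (x i) (Ri i + r))).toReal
        - ∑ T ∈ I.powersetCard 2,
            (volume (⋂ i ∈ T, Metric.closedBall (x i) (Ri i + r))).toReal
        + ∑ T ∈ I.powersetCard 3,
            (volume (⋂ i ∈ T, Metric.closedBall (x i) (Ri i + r))).toReal := by
  refine measureReal_biUnion_eq_of_card_filter_le_three volume I _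
    (fun i _ ↦ Metric.isClosed_closedBall.measurableSet)
    (fun i _ ↦ measure_closedBall_lt_top.ne) fun y S hSI hy ↦ ?_
  by_contra! hS
  obtain ⟨i, hi, j, hj, hij, hinner⟩ := exists_inner_nonneg_of_three_lt_card S hS (x · - y)
  have hsep := hhc i (hSI hi) j (hSI hj) hij
  have hRi' := hRi i (hSI hi)
  have hRj' := hRi j (hSI hj)
  have hyi : ‖x i - y‖ ≤ Ri i + r := by
    simpa [dist_eq_norm, norm_sub_rev] using hy i hi
  have hyj : ‖x j - y‖ ≤ Ri j + r := by
    simpa [dist_eq_norm, norm_sub_rev] using hy j hj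
  have hexp := norm_sub_sq_real (x i - y) (x j - y)
  rw [sub_sub_sub_cancel_right, ← dist_eq_norm (x i) (x j)] at hexp
  have hlt : (Ri i + Ri j) ^ 2 < dist (x i) (x j) ^ 2 :=
    pow_lt_pow_left₀ hsep (by linarith) two_ne_zero
  have hsqi := pow_le_pow_left₀ (norm_nonneg _) hyi 2
  have hsqj := pow_le_pow_left₀ (norm_nonneg _) hyj 2
  linarith [add_sq_add_add_sq_le_add_sq hr0 hr hRi' hRj']
end

section
/- Let R ≥ 0 and let x₁, x₂, x₃, x₄ be points in ℝ^d (any d ≥ 1) with |x_i − x_j| ≥ 2R for all i ≠ j. Then for every point z ∈ ℝ^d, max_{1 ≤ i ≤ 4} |x_i − z| ≥ √(3/2) · R. -/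
/-- The sum of the squared mutual distances of a finite family of vectors, in terms of the
squared norms of the vectors and of their sum. -/
theorem sum_sum_norm_sub_sq {ι E : Type*} [Fintype ι] [NormedAddCommGroup E]
    [InnerProductSpace ℝ E] (v : ι → E) :
    ∑ i, ∑ j, ‖v i - v j‖ ^ 2 =
      2 * Fintype.card ι * ∑ i, ‖v i‖ ^ 2 - 2 * ‖∑ i, v i‖ ^ 2 := by
  have h : ‖∑ i, v i‖ ^ 2 = ∑ i, ∑ j, inner ℝ (v i) (v j) := by
    rw [← real_inner_self_eq_norm_sq, sum_inner]
    simp_rw [inner_sum]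
  simp_rw [h, norm_sub_sq_real, Finset.sum_add_distrib, Finset.sum_sub_distrib, Finset.sum_const,
    ← Finset.mul_sum, Finset.card_univ, nsmul_eq_mul, ← Finset.mul_sum]
  ring

/-- The sum of the squared mutual distances of a finite family of points is controlled by the
squared distances of these points to any common point. -/
theorem sum_sum_dist_sq_le {ι E : Type*} [Fintype ι] [NormedAddCommGroup E]
    [InnerProductSpace ℝ E] (x : ι → E) (z : E) :
    ∑ i, ∑ j, dist (x i) (x j) ^ 2 ≤ 2 * Fintype.card ι * ∑ i, dist (x i) z ^ 2 := by
  have h := sum_sum_norm_sub_sq fun i => x i - z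
  simp only [sub_sub_sub_cancel_right] at h
  simp only [dist_eq_norm, h]
  linarith [sq_nonneg ‖∑ i, (x i - z)‖]


/-- if `R ≥ 0` and four points of `ℝ^d` are pairwise at distance at least `2R`,
then for every point `z` the largest of the four distances `|x i − z|` is at least
`√(3/2) · R`. -/
theorem exists_far_point_of_separated (d : ℕ) (hd : 1 ≤ d) (R : ℝ) (hR : 0 ≤ R)
    (x : Fin 4 → EuclideanSpace ℝ (Fin d))
    (hsep : ∀ i j, i ≠ j → 2 * R ≤ dist (x i) (x j)) :
    ∀ z : EuclideanSpace ℝ (Fin d), ∃ i, Real.sqrt (3 / 2) * R ≤ dist (x i) z := by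
  intro z
  by_contra! hfar
  have hsq (i : Fin 4) : dist (x i) z ^ 2 < 3 / 2 * R ^ 2 := by
    have h := pow_lt_pow_left₀ (hfar i) dist_nonneg two_ne_zero
    rwa [mul_pow, Real.sq_sqrt (by norm_num)] at h
  have hlow (i j : Fin 4) (hij : i ≠ j) : 4 * R ^ 2 ≤ dist (x i) (x j) ^ 2 := by
    have h := pow_le_pow_left₀ (by positivity) (hsep i j hij) 2
    linarith
  have hoff (i : Fin 4) : 12 * R ^ 2 ≤ ∑ j, dist (x i) (x j) ^ 2 := by
    have h := Finset.card_nsmul_le_sum (Finset.univ.erase i) (fun j => dist (x i) (x j) ^ 2) _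
      fun j hj => hlow i j (Finset.ne_of_mem_erase hj).symm
    rw [← Finset.add_sum_erase _ _ (Finset.mem_univ i)]
    simp at h ⊢
    linarith
  have htotal := Finset.card_nsmul_le_sum Finset.univ _ _ fun i _ => hoff i
  have hupper := Finset.sum_lt_sum_of_nonempty Finset.univ_nonempty fun i _ => hsq i
  have hle := sum_sum_dist_sq_le x z
  simp only [Finset.card_univ, Finset.sum_const, Fintype.card_fin, nsmul_eq_mul] at *
  push_cast at *
  linarith
end

section
/- Let d ≥ 1, R > 0, 0 ≤ r ≤ (√(3/2) − 1)·R, and let x₁, x₂, x₃, x₄ ∈ ℝ^d satisfy |x_i − x_j| > 2R for all i ≠ j. Then ⋂_{i=1}^{4} B(x_i, R + r) = ∅, i.e., there is no point z with |z − x_i| ≤ R + r for all i. -/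
/-- The six squared pairwise distances of four vectors sum to at most four times the sum of the
squared norms. -/
theorem sum_sq_norm_sub_le_four_mul_sum_sq_norm {E : Type*} [NormedAddCommGroup E]
    [InnerProductSpace ℝ E] (a b c e : E) :
    ‖a - b‖ ^ 2 + ‖a - c‖ ^ 2 + ‖a - e‖ ^ 2 + ‖b - c‖ ^ 2 + ‖b - e‖ ^ 2 + ‖c - e‖ ^ 2 ≤
      4 * (‖a‖ ^ 2 + ‖b‖ ^ 2 + ‖c‖ ^ 2 + ‖e‖ ^ 2) := by
  have h := sq_nonneg ‖a + b + c + e‖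
  simp only [norm_add_sq_real, inner_add_left] at h
  simp only [norm_sub_sq_real]
  linarith

/-- if `d ≥ 1`, `R > 0`, `0 ≤ r ≤ (√(3/2) − 1)·R` and the four points
`x 0, …, x 3 ∈ ℝ^d` satisfy `|x i − x j| > 2R` for `i ≠ j`, then the four enlarged balls
`B(x i, R + r)` have empty intersection. -/
theorem four_enlarged_balls_empty_inter (d : ℕ) (hd : 1 ≤ d) (R r : ℝ) (hR : 0 < R)
    (hr0 : 0 ≤ r) (hr : r ≤ (Real.sqrt (3 / 2) - 1) * R)
    (x : Fin 4 → EuclideanSpace ℝ (Fin d))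
    (hsep : ∀ i j, i ≠ j → 2 * R < dist (x i) (x j)) :
    ⋂ i, Metric.closedBall (x i) (R + r) = ∅ := by
  refine Set.eq_empty_iff_forall_notMem.2 fun z hz => ?_
  have hball (i : Fin 4) : ‖x i - z‖ ^ 2 ≤ 3 / 2 * R ^ 2 := by
    have hi : ‖x i - z‖ ≤ R + r := by
      rw [← dist_eq_norm, dist_comm]
      exact Set.mem_iInter.1 hz i
    calc ‖x i - z‖ ^ 2 ≤ (Real.sqrt (3 / 2) * R) ^ 2 :=
          pow_le_pow_left₀ (norm_nonneg _) (by linarith) 2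
      _ = 3 / 2 * R ^ 2 := by rw [mul_pow, Real.sq_sqrt (by norm_num)]
  have hdist (i j : Fin 4) (hij : i ≠ j) : 4 * R ^ 2 < ‖(x i - z) - (x j - z)‖ ^ 2 := by
    rw [sub_sub_sub_cancel_right, ← dist_eq_norm]
    calc 4 * R ^ 2 = (2 * R) ^ 2 := by ring
      _ < dist (x i) (x j) ^ 2 := pow_lt_pow_left₀ (hsep i j hij) (by positivity) two_ne_zero
  have hsum := sum_sq_norm_sub_le_four_mul_sum_sq_norm (x 0 - z) (x 1 - z) (x 2 - z) (x 3 - z)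
  linarith [hball 0, hball 1, hball 2, hball 3, hdist 0 1 (by decide), hdist 0 2 (by decide),
    hdist 0 3 (by decide), hdist 1 2 (by decide), hdist 1 3 (by decide), hdist 2 3 (by decide)]
end

section
/- For every ε > 0 there exists r > 0 such that for all x ≥ 0, ψ(x) := 1 − x + x·log x ≥ (|x − 1| − ε/2)/r, where x·log x is interpreted as 0 at x = 0. -/
/-- Young's inequality for the conjugate pair `x * log x - x` and `exp`. -/
theorem mul_le_mul_log_sub_add_exp {x : ℝ} (hx : 0 ≤ x) (s : ℝ) :
    x * s ≤ x * Real.log x - x + Real.exp s := by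
  rcases hx.eq_or_lt with rfl | hx
  · simpa using (Real.exp_pos s).le
  · have h := mul_le_mul_of_nonneg_left (Real.add_one_le_exp (s - Real.log x)) hx.le
    rw [Real.exp_sub, Real.exp_log hx, mul_div_cancel₀ _ hx.ne'] at h
    linarith

theorem mul_abs_sub_one_sub_sq_le {x t : ℝ} (hx : 0 ≤ x) (ht₀ : 0 ≤ t) (ht₁ : t ≤ 1) :
    t * |x - 1| - t ^ 2 ≤ 1 - x + x * Real.log x := by
  have key (s : ℝ) (hs : |s| ≤ 1) : s * (x - 1) - s ^ 2 ≤ 1 - x + x * Real.log x := by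
    linarith [mul_le_mul_log_sub_add_exp hx s,
      (abs_le.mp (Real.abs_exp_sub_one_sub_id_le hs)).2]
  have ht : |t| ≤ 1 := by rwa [abs_of_nonneg ht₀]
  rcases abs_choice (x - 1) with h | h
  · rw [h]
    exact key t ht
  · rw [h]
    linarith [key (-t) (by rwa [abs_neg])]

/-- for every `ε > 0` there is `r > 0` such that for all `x ≥ 0`,
`ψ(x) = 1 − x + x·log x ≥ (|x − 1| − ε/2)/r` (with `x·log x = 0` at `x = 0`, as is the
convention of `Real.log`). -/
theorem psi_lower_bound :
    ∀ ε : ℝ, 0 < ε → ∃ r : ℝ, 0 < r ∧ ∀ x : ℝ, 0 ≤ x →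
      (|x - 1| - ε / 2) / r ≤ 1 - x + x * Real.log x := by
  intro ε hε
  obtain ⟨t, ht₀, ht₁, htε⟩ : ∃ t : ℝ, 0 < t ∧ t ≤ 1 ∧ t ≤ ε / 2 :=
    ⟨min 1 (ε / 2), by positivity, min_le_left _ _, min_le_right _ _⟩
  refine ⟨t⁻¹, inv_pos.mpr ht₀, fun x hx => ?_⟩
  rw [div_inv_eq_mul]
  linarith [mul_abs_sub_one_sub_sq_le hx ht₀.le ht₁, mul_le_mul_of_nonneg_left htε ht₀.le]
end

section
/- Let d ≥ 1 and r ≥ 0, and let ω ⊆ ℝ^d × [0,∞) be a configuration of marked points whose positions are locally finite (for every n ∈ ℕ the set {(y,R) ∈ ω : |y| ≤ n} is finite) and which satisfies the hard-core condition: |y − y'| > R + R' for all distinct (y,R), (y',R') ∈ ω. Then for every x ∈ ℝ^d and every ρ ≥ 0, the set {(y,R) ∈ ω : B(y, R + r) ∩ B(x, ρ) ≠ ∅} is finite. -/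
/-- Among marked balls satisfying the hard-core condition, only finitely many of radius at least `1`
come within distance `M` of a given point `x`: each of them contains a point of a fixed finite
`1`-net of the ball of radius `M + 1` around `x`, and the balls are disjoint. -/
theorem finite_setOf_one_le_radius_of_hardCore {E : Type*} [NormedAddCommGroup E] [NormedSpace ℝ E]
    [ProperSpace E] {ω : Set (E × ℝ)}
    (hhc : ∀ p ∈ ω, ∀ q ∈ ω, p ≠ q → p.2 + q.2 < dist p.1 q.1) (x : E) {M : ℝ} (hM : 0 ≤ M) :
    {p ∈ ω | 1 ≤ p.2 ∧ dist p.1 x ≤ p.2 + M}.Finite := by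
  obtain ⟨t, ht, hcover⟩ :=
    Metric.totallyBounded_iff.1 (isCompact_closedBall x (M + 1)).totallyBounded 1 one_pos
  have exists_center : ∀ p ∈ {p ∈ ω | 1 ≤ p.2 ∧ dist p.1 x ≤ p.2 + M},
      ∃ c ∈ t, dist p.1 c < p.2 := by
    rintro p ⟨-, hp1, hpx⟩
    obtain ⟨z, hpz, hzx⟩ := exists_dist_le_le (sub_nonneg.2 hp1) (by linarith : 0 ≤ M + 1)
      (by linarith : dist p.1 x ≤ M + 1 + (p.2 - 1))
    obtain ⟨c, hc, hzc⟩ := Set.mem_iUnion₂.1 (hcover (Metric.mem_closedBall.2 hzx))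
    rw [Metric.mem_ball] at hzc
    exact ⟨c, hc, by linarith [dist_triangle p.1 z c]⟩
  choose! f hft hf using exists_center
  refine Set.Finite.of_injOn (f := f) hft (fun p hp q hq hpq => ?_) ht
  by_contra hne
  have hfq := hf q hq
  rw [← hpq] at hfq
  linarith [hf p hp, hhc p hp.1 q hq.1 hne, dist_triangle_right p.1 q.1 (f p)]

/-- let `ω ⊆ ℝ^d × [0,∞)` be a configuration of marked points with locally
finite positions satisfying the hard-core condition `|y − y'| > R + R'` for distinct points.
Then for every `x ∈ ℝ^d` and `ρ ≥ 0` only finitely many of the enlarged balls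
`B(y, R + r)`, `(y, R) ∈ ω`, intersect the ball `B(x, ρ)`. -/
theorem finitely_many_enlarged_balls_meet (d : ℕ) (hd : 1 ≤ d) (r : ℝ) (hr : 0 ≤ r)
    (ω : Set (EuclideanSpace ℝ (Fin d) × ℝ))
    (hpos : ∀ p ∈ ω, 0 ≤ p.2)
    (hloc : ∀ n : ℕ, {p ∈ ω | ‖p.1‖ ≤ (n : ℝ)}.Finite)
    (hhc : ∀ p ∈ ω, ∀ q ∈ ω, p ≠ q → p.2 + q.2 < dist p.1 q.1) :
    ∀ (x : EuclideanSpace ℝ (Fin d)) (ρ : ℝ), 0 ≤ ρ →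
      {p ∈ ω |
        (Metric.closedBall p.1 (p.2 + r) ∩ Metric.closedBall x ρ).Nonempty}.Finite := by
  intro x ρ hρ
  have dist_le_of_meet : ∀ p : EuclideanSpace ℝ (Fin d) × ℝ,
      (Metric.closedBall p.1 (p.2 + r) ∩ Metric.closedBall x ρ).Nonempty →
        dist p.1 x ≤ p.2 + (r + ρ) := by
    rintro p ⟨z, hzp, hzx⟩
    rw [Metric.mem_closedBall] at hzp hzx
    linarith [dist_triangle_left p.1 x z]
  obtain ⟨n, hn⟩ := exists_nat_ge (‖x‖ + (r + ρ) + 1)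
  refine ((hloc n).union
    (finite_setOf_one_le_radius_of_hardCore hhc x (add_nonneg hr hρ))).subset ?_
  rintro p ⟨hp, hmeet⟩
  have hdist := dist_le_of_meet p hmeet
  rcases le_total 1 p.2 with h | h
  · exact Or.inr ⟨hp, h, hdist⟩
  · refine Or.inl ⟨hp, ?_⟩
    rw [dist_eq_norm] at hdist
    linarith [norm_le_norm_add_norm_sub x p.1, norm_sub_rev x p.1]
end
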